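/- arXiv:1404.1432 — 6 statements merged into one kernel-verified Lean document; each statement's English description precedes it below -/
import Mathlib

section
/- Let 𝔤 be a finite-dimensional real Lie algebra with a stratification 𝔤¹,…,𝔤ʳ, and let an inner product be given on 𝔤¹. Then there exists an inner product on 𝔤 whose restriction to 𝔤¹ is the given one, for which the subspaces 𝔤¹,…,𝔤ʳ are pairwise orthogonal, and such that for every k = 1,…,r−1 the restriction of the bracket map B_k to the orthogonal complement of its kernel is an isometric linear isomorphism onto 𝔤^{k+1}. -/
open TensorProduct

/-- A bilinear form is an inner product if it is symmetric and positive definite. -/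
def IsInnerProduct {V : Type*} [AddCommGroup V] [Module ℝ V]
    (B : LinearMap.BilinForm ℝ V) : Prop :=
  (∀ x y, B x y = B y x) ∧ (∀ x, x ≠ 0 → 0 < B x x)

/-- The linear map `B_k : V ⊗ W → L` determined by `x ⊗ y ↦ [x, y]`, for subspaces
`V`, `W` of a Lie algebra `L`. -/
noncomputable def bracketTensorMap (L : Type*) [LieRing L] [LieAlgebra ℝ L]
    (V W : Submodule ℝ L) : (↥V ⊗[ℝ] ↥W) →ₗ[ℝ] L :=
  TensorProduct.lift (LinearMap.mk₂ ℝ (fun (x : ↥V) (y : ↥W) => ⁅(x : L), (y : L)⁆)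
    (fun x x' y => by simp [add_lie])
    (fun c x y => by simp [smul_lie])
    (fun x y y' => by simp [lie_add])
    (fun c x y => by simp [lie_smul]))

open scoped DirectSum

namespace IsInnerProduct

variable {V W : Type*} [AddCommGroup V] [Module ℝ V] [AddCommGroup W] [Module ℝ W]

theorem isSymm {B : LinearMap.BilinForm ℝ V} (hB : IsInnerProduct B) : LinearMap.IsSymm B :=
  ⟨hB.1⟩

/-- A symmetric bilinear form with an orthogonal basis of vectors of positive square is an
inner product. -/
theorem of_orthogonal_basis {ι : Type*} [Fintype ι] {B : LinearMap.BilinForm ℝ V}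
    (hB : ∀ x y, B x y = B y x) (v : Module.Basis ι ℝ V)
    (hv : ∀ i j, i ≠ j → B (v i) (v j) = 0) (hpos : ∀ i, 0 < B (v i) (v i)) :
    IsInnerProduct B := by
  refine ⟨hB, fun x hx ↦ ?_⟩
  have key : B x x = ∑ i, v.repr x i ^ 2 * B (v i) (v i) := by
    conv_lhs => rw [← v.sum_repr x]
    simp only [map_sum, map_smul, LinearMap.sum_apply, LinearMap.smul_apply, smul_eq_mul]
    refine Finset.sum_congr rfl fun i _ ↦ ?_
    rw [Finset.sum_eq_single i (fun j _ hj ↦ by simp [hv j i hj]) (by simp)]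
    ring
  obtain ⟨i, hi⟩ : ∃ i, v.repr x i ≠ 0 := by
    by_contra! h
    exact hx (v.ext_elem (by simpa using h))
  rw [key]
  exact Finset.sum_pos' (fun j _ ↦ mul_nonneg (sq_nonneg _) (hpos j).le)
    ⟨i, Finset.mem_univ i, mul_pos (by positivity) (hpos i)⟩

theorem tmul [FiniteDimensional ℝ V] [FiniteDimensional ℝ W]
    {B : LinearMap.BilinForm ℝ V} {C : LinearMap.BilinForm ℝ W}
    (hB : IsInnerProduct B) (hC : IsInnerProduct C) :
    IsInnerProduct (V := V ⊗[ℝ] W) (LinearMap.BilinForm.tmul B C) := by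
  obtain ⟨v, hv⟩ := LinearMap.BilinForm.exists_orthogonal_basis hB.isSymm
  obtain ⟨w, hw⟩ := LinearMap.BilinForm.exists_orthogonal_basis hC.isSymm
  refine of_orthogonal_basis (hB.isSymm.tmul hC.isSymm).eq (v.tensorProduct w) ?_ ?_
  · rintro ⟨i, j⟩ ⟨i', j'⟩ h
    simp only [Module.Basis.tensorProduct_apply, LinearMap.BilinForm.tensorDistrib_tmul,
      smul_eq_mul]
    by_cases hi : i = i'
    · have hj : j ≠ j' := fun hj ↦ h (by rw [hi, hj])
      rw [show C (w j) (w j') = 0 from hw hj, zero_mul]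
    · rw [show B (v i) (v i') = 0 from hv hi, mul_zero]
  · rintro ⟨i, j⟩
    simp only [Module.Basis.tensorProduct_apply, LinearMap.BilinForm.tensorDistrib_tmul,
      smul_eq_mul]
    exact mul_pos (hC.2 _ (w.ne_zero j)) (hB.2 _ (v.ne_zero i))

theorem isCompl_orthogonal [FiniteDimensional ℝ V] {B : LinearMap.BilinForm ℝ V}
    (hB : IsInnerProduct B) (U : Submodule ℝ V) : IsCompl U (B.orthogonal U) := by
  rw [LinearMap.BilinForm.isCompl_orthogonal_iff_disjoint hB.isSymm.isRefl,
    Submodule.disjoint_def]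
  intro x hx hx'
  by_contra h
  exact (hB.2 x h).ne' (hx' x hx)

theorem map_orthogonal_ker [FiniteDimensional ℝ V] {B : LinearMap.BilinForm ℝ V}
    (hB : IsInnerProduct B) (f : V →ₗ[ℝ] W) :
    (B.orthogonal f.ker).map f = f.range := by
  rw [← Submodule.map_top, ← (hB.isCompl_orthogonal f.ker).sup_eq_top, Submodule.map_sup,
    (LinearMap.le_ker_iff_map (f := f)).1 le_rfl, bot_sup_eq]

theorem eq_zero_of_mem_orthogonal_ker [FiniteDimensional ℝ V] {B : LinearMap.BilinForm ℝ V}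
    (hB : IsInnerProduct B) (f : V →ₗ[ℝ] W) {z : V} (hz : z ∈ B.orthogonal f.ker)
    (hfz : f z = 0) : z = 0 :=
  Submodule.disjoint_def.1 (hB.isCompl_orthogonal f.ker).disjoint z hfz hz

/-- An inner product on the source of a linear map induces one on its range, for which the map is
isometric on the orthogonal complement of its kernel. -/
theorem exists_pushforward [FiniteDimensional ℝ V] {B : LinearMap.BilinForm ℝ V}
    (hB : IsInnerProduct B) (f : V →ₗ[ℝ] W) :
    ∃ C : LinearMap.BilinForm ℝ W, IsInnerProduct (C.restrict f.range) ∧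
      ∀ z ∈ B.orthogonal f.ker, ∀ w ∈ B.orthogonal f.ker, C (f z) (f w) = B z w := by
  obtain ⟨s, hs⟩ := (f.domRestrict (B.orthogonal f.ker)).exists_leftInverse_of_injective <| by
    rw [LinearMap.ker_eq_bot']
    exact fun z hz ↦ Subtype.ext (hB.eq_zero_of_mem_orthogonal_ker f z.2 hz)
  have hs' (z) (hz : z ∈ B.orthogonal f.ker) : (s (f z) : V) = z :=
    congrArg Subtype.val (LinearMap.congr_fun hs ⟨z, hz⟩)
  refine ⟨B.compl₁₂ ((Submodule.subtype _).comp s) ((Submodule.subtype _).comp s),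
    ⟨fun x y ↦ hB.1 _ _, ?_⟩, fun z hz w hw ↦ ?_⟩
  · rintro ⟨x, hx⟩ hx0
    rw [← hB.map_orthogonal_ker] at hx
    obtain ⟨z, hz, rfl⟩ := hx
    have hz0 : z ≠ 0 := fun h ↦ hx0 (Subtype.ext (by simp [h]))
    simpa [hs' z hz] using hB.2 z hz0
  · simp [hs' z hz, hs' w hw]

end IsInnerProduct

theorem range_bracketTensorMap (L : Type*) [LieRing L] [LieAlgebra ℝ L] (V W : Submodule ℝ L) :
    (bracketTensorMap L V W).range =
      Submodule.span ℝ {z : L | ∃ x ∈ V, ∃ y ∈ W, z = ⁅x, y⁆} := by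
  rw [← Submodule.map_top, ← TensorProduct.span_tmul_eq_top, Submodule.map_span]
  congr 1
  ext z
  constructor
  · rintro ⟨_, ⟨x, y, rfl⟩, rfl⟩
    exact ⟨x, x.2, y, y.2, by simp [bracketTensorMap]⟩
  · rintro ⟨x, hx, y, hy, rfl⟩
    exact ⟨_, ⟨⟨x, hx⟩, ⟨y, hy⟩, rfl⟩, by simp [bracketTensorMap]⟩

/-- Inner products on the summands of an internal direct sum assemble to an inner product for
which the summands are orthogonal. -/
theorem DirectSum.IsInternal.exists_isInnerProduct {ι V : Type*} [Fintype ι] [DecidableEq ι]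
    [AddCommGroup V] [Module ℝ V] {g : ι → Submodule ℝ V} (hg : DirectSum.IsInternal g)
    (C : ∀ i, LinearMap.BilinForm ℝ (g i)) (hC : ∀ i, IsInnerProduct (C i)) :
    ∃ B : LinearMap.BilinForm ℝ V, IsInnerProduct B ∧ (∀ i, B.restrict (g i) = C i) ∧
      ∀ i j, i ≠ j → ∀ x ∈ g i, ∀ y ∈ g j, B x y = 0 := by
  let e := LinearEquiv.ofBijective (DirectSum.coeLinearMap g) hg
  let p (i : ι) : V →ₗ[ℝ] g i := (DirectSum.component ℝ ι (fun i ↦ g i) i).comp e.symm.toLinearMap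
  have hp (i : ι) (x : g i) : p i x = x := hg.ofBijective_coeLinearMap_same x
  have hp' (i j : ι) (hij : i ≠ j) (x : g i) : p j x = 0 := hg.ofBijective_coeLinearMap_of_ne hij x
  have hB (x y : V) : (∑ i, (C i).compl₁₂ (p i) (p i)) x y = ∑ i, C i (p i x) (p i y) := by
    simp [LinearMap.sum_apply]
  refine ⟨∑ i, (C i).compl₁₂ (p i) (p i), ⟨fun x y ↦ ?_, fun x hx ↦ ?_⟩, fun i ↦ ?_,
    fun i j hij x hx y hy ↦ ?_⟩
  · simp only [hB]
    exact Finset.sum_congr rfl fun i _ ↦ (hC i).1 _ _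
  · obtain ⟨i, hi⟩ : ∃ i, p i x ≠ 0 := by
      by_contra! h
      exact hx (e.symm.map_eq_zero_iff.1 (DFinsupp.ext h))
    rw [hB]
    refine Finset.sum_pos' (fun j _ ↦ ?_) ⟨i, Finset.mem_univ i, (hC i).2 _ hi⟩
    by_cases h : p j x = 0
    · simp [h]
    · exact ((hC j).2 _ h).le
  · ext x y
    change (∑ i, (C i).compl₁₂ (p i) (p i)) (x : V) (y : V) = _
    rw [hB, Finset.sum_eq_single i (fun j _ hj ↦ by rw [hp' i j hj.symm x]; simp) (by simp),
      hp, hp]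
  · rw [hB]
    refine Finset.sum_eq_zero fun k _ ↦ ?_
    by_cases hk : i = k
    · rw [hp' j k (fun h ↦ hij (hk.trans h.symm)) ⟨y, hy⟩, map_zero]
    · rw [hp' i k hk ⟨x, hx⟩, map_zero, LinearMap.zero_apply]

/-- **Canonical extension of an inner product on the first stratum.**
Let `𝔤` be a finite-dimensional real Lie algebra with a stratification
`g 0, …, g (r-1)` and let `B₁` be an inner product on the first stratum `g 0`.
Then there is an inner product `B` on `𝔤` restricting to `B₁` on `g 0`, making the
strata pairwise orthogonal, and such that for every `k` the bracket map
`B_k : g 0 ⊗ g k → g (k+1)`, restricted to the orthogonal complement of its kernel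
(with respect to the tensor-product inner product), is an isometric linear
isomorphism onto `g (k+1)`. -/
theorem stmt0 (L : Type*) [LieRing L] [LieAlgebra ℝ L] [FiniteDimensional ℝ L]
    (r : ℕ) (hr : 0 < r) (g : Fin r → Submodule ℝ L)
    (hdirect : DirectSum.IsInternal g)
    (hstrat : ∀ j : ℕ, ∀ hj : j + 1 < r,
      Submodule.span ℝ
          {z : L | ∃ x ∈ g ⟨0, hr⟩, ∃ y ∈ g ⟨j, Nat.lt_of_succ_lt hj⟩, z = ⁅x, y⁆}
        = g ⟨j + 1, hj⟩)
    (htop : ∀ j : Fin r, ∀ x ∈ g j, ∀ y ∈ g ⟨r - 1, Nat.sub_lt hr Nat.one_pos⟩,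
      ⁅x, y⁆ = 0)
    (B₁ : LinearMap.BilinForm ℝ ↥(g ⟨0, hr⟩)) (hB₁ : IsInnerProduct B₁) :
    ∃ B : LinearMap.BilinForm ℝ L,
      IsInnerProduct B ∧
      (∀ x y : ↥(g ⟨0, hr⟩), B x y = B₁ x y) ∧
      (∀ i j : Fin r, i ≠ j → ∀ x ∈ g i, ∀ y ∈ g j, B x y = 0) ∧
      (∀ k : ℕ, ∀ hk : k + 1 < r,
        let gk : Submodule ℝ L := g ⟨k, Nat.lt_of_succ_lt hk⟩
        let Bk : (↥(g ⟨0, hr⟩) ⊗[ℝ] ↥gk) →ₗ[ℝ] L := bracketTensorMap L (g ⟨0, hr⟩) gk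
        let T : LinearMap.BilinForm ℝ (↥(g ⟨0, hr⟩) ⊗[ℝ] ↥gk) :=
          LinearMap.BilinForm.tmul B₁ (LinearMap.BilinForm.restrict B gk)
        let K : Submodule ℝ (↥(g ⟨0, hr⟩) ⊗[ℝ] ↥gk) :=
          LinearMap.BilinForm.orthogonal T (LinearMap.ker Bk)
        Submodule.map Bk K = g ⟨k + 1, hk⟩ ∧
        (∀ z ∈ K, Bk z = 0 → z = 0) ∧
        (∀ z ∈ K, ∀ w ∈ K, B (Bk z) (Bk w) = T z w)) := by
  let P (k : ℕ) (C : LinearMap.BilinForm ℝ L) : Prop :=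
    ∀ hk : k < r, IsInnerProduct (C.restrict (g ⟨k, hk⟩))
  have step (k : ℕ) (C : LinearMap.BilinForm ℝ L) (hC : P k C) :
      ∃ D : LinearMap.BilinForm ℝ L, P (k + 1) D ∧ ∀ hk : k + 1 < r,
        let f := bracketTensorMap L (g ⟨0, hr⟩) (g ⟨k, Nat.lt_of_succ_lt hk⟩)
        let T : LinearMap.BilinForm ℝ (g ⟨0, hr⟩ ⊗[ℝ] g ⟨k, Nat.lt_of_succ_lt hk⟩) :=
          LinearMap.BilinForm.tmul B₁ (C.restrict (g ⟨k, Nat.lt_of_succ_lt hk⟩))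
        ∀ z ∈ T.orthogonal f.ker, ∀ w ∈ T.orthogonal f.ker, D (f z) (f w) = T z w := by
    by_cases hk : k + 1 < r
    · obtain ⟨D, hD, hDT⟩ := (hB₁.tmul (hC (Nat.lt_of_succ_lt hk))).exists_pushforward
        (bracketTensorMap L (g ⟨0, hr⟩) (g ⟨k, Nat.lt_of_succ_lt hk⟩))
      rw [range_bracketTensorMap, hstrat k hk] at hD
      exact ⟨D, fun _ ↦ hD, fun _ ↦ hDT⟩
    · exact ⟨0, fun h ↦ absurd h hk, fun h ↦ absurd h hk⟩
  choose next hnext hnextT using step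
  obtain ⟨q, hq⟩ := (g ⟨0, hr⟩).subtype.exists_leftInverse_of_injective (Submodule.ker_subtype _)
  have hq' (x : g ⟨0, hr⟩) : q x = x := LinearMap.congr_fun hq x
  have hrestrict : LinearMap.BilinForm.restrict (B₁.compl₁₂ q q) (g ⟨0, hr⟩) = B₁ := by
    ext x y
    simp [hq']
  let C : ∀ k, {C : LinearMap.BilinForm ℝ L // P k C} := fun k ↦
    Nat.rec ⟨B₁.compl₁₂ q q, fun _ ↦ by rwa [hrestrict]⟩
      (fun k C ↦ ⟨next k C.1 C.2, hnext k C.1 C.2⟩) k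
  obtain ⟨B, hB, hBC, horth⟩ := hdirect.exists_isInnerProduct
    (fun i ↦ (C i).1.restrict (g i)) (fun i ↦ (C i).2 i.2)
  refine ⟨B, hB, fun x y ↦ ?_, horth, fun k hk ↦ ?_⟩
  · exact (LinearMap.congr_fun₂ (hBC ⟨0, hr⟩) x y).trans (LinearMap.congr_fun₂ hrestrict x y)
  · intro gk Bk T K
    have hBk : B.restrict gk = (C k).1.restrict gk := hBC ⟨k, Nat.lt_of_succ_lt hk⟩
    have hT : IsInnerProduct T := hB₁.tmul (by rw [hBk]; exact (C k).2 _)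
    have hrange : Bk.range = g ⟨k + 1, hk⟩ := by rw [range_bracketTensorMap, hstrat k hk]
    refine ⟨(hT.map_orthogonal_ker Bk).trans hrange,
      fun z hz ↦ hT.eq_zero_of_mem_orthogonal_ker Bk hz, fun z hz w hw ↦ ?_⟩
    have hmem (z) : Bk z ∈ g ⟨k + 1, hk⟩ := hrange ▸ LinearMap.mem_range_self Bk z
    have h := LinearMap.congr_fun₂ (hBC ⟨k + 1, hk⟩) ⟨Bk z, hmem z⟩ ⟨Bk w, hmem w⟩
    have hnext' := hnextT k (C k).1 (C k).2 hk
    simp only [K, T, hBk] at hz hw ⊢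
    exact h.trans (hnext' z hz w hw)
end

section
/- Let 𝔤 be a finite-dimensional real Lie algebra with a stratification 𝔤¹,…,𝔤ʳ, let an inner product be given on 𝔤¹, and let ⟨·,·⟩ be an adapted inner product on 𝔤. If f : 𝔤 → 𝔤 is a Lie algebra automorphism satisfying f(𝔤ʲ) = 𝔤ʲ for every j whose restriction to 𝔤¹ preserves the inner product, then f preserves ⟨·,·⟩ on all of 𝔤, i.e. ⟨f(X), f(Y)⟩ = ⟨X, Y⟩ for all X, Y ∈ 𝔤. -/
open TensorProduct

/-- A Lie algebra endomorphism mapping `V` and `W` to themselves is intertwined by the bracket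
map `V ⊗ W → L` with its restriction to `V ⊗ W`. -/
theorem bracketTensorMap_map_restrict {L : Type*} [LieRing L] [LieAlgebra ℝ L]
    {V W : Submodule ℝ L} (f : L →ₗ⁅ℝ⁆ L)
    (hV : ∀ x ∈ V, (f : L →ₗ[ℝ] L) x ∈ V) (hW : ∀ x ∈ W, (f : L →ₗ[ℝ] L) x ∈ W)
    (z : ↥V ⊗[ℝ] ↥W) :
    bracketTensorMap L V W (TensorProduct.map ((f : L →ₗ[ℝ] L).restrict hV)
      ((f : L →ₗ[ℝ] L).restrict hW) z) = f (bracketTensorMap L V W z) := by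
  induction z with
  | zero => simp
  | add a b ha hb => simp only [map_add, ha, hb]
  | tmul x y => simp [bracketTensorMap]

/-- The tensor product of two isometries is an isometry of the tensor product form. -/
theorem tmul_map_map_of_isometry {V W : Type*} [AddCommGroup V] [Module ℝ V]
    [AddCommGroup W] [Module ℝ W] (B : LinearMap.BilinForm ℝ V) (C : LinearMap.BilinForm ℝ W)
    (p : V →ₗ[ℝ] V) (q : W →ₗ[ℝ] W) (hp : ∀ x y, B (p x) (p y) = B x y)
    (hq : ∀ x y, C (q x) (q y) = C x y) (z w : V ⊗[ℝ] W) :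
    LinearMap.BilinForm.tmul B C (TensorProduct.map p q z) (TensorProduct.map p q w) =
      LinearMap.BilinForm.tmul B C z w := by
  induction z with
  | zero => simp
  | add a b ha hb => simp only [map_add, LinearMap.add_apply, ha, hb]
  | tmul x y =>
    induction w with
    | zero => simp
    | add a b ha hb => simp only [map_add, ha, hb]
    | tmul x' y' => simp [hp, hq]

/-- A surjective linear map that preserves a bilinear form, and for which the preimage of `N` is
contained in `N`, maps the orthogonal complement of `N` to itself. -/
theorem map_mem_orthogonal_of_isometry {M : Type*} [AddCommGroup M] [Module ℝ M]
    (T : LinearMap.BilinForm ℝ M) (N : Submodule ℝ M) (φ : M →ₗ[ℝ] M)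
    (hT : ∀ z w, T (φ z) (φ w) = T z w) (hφ : Function.Surjective φ)
    (hN : ∀ w, φ w ∈ N → w ∈ N) {z : M} (hz : z ∈ LinearMap.BilinForm.orthogonal T N) :
    φ z ∈ LinearMap.BilinForm.orthogonal T N := by
  intro n hn
  obtain ⟨w, rfl⟩ := hφ n
  exact (hT w z).trans (hz w (hN w hn))

/-- **Graded automorphisms which are isometries on the first stratum are isometries.**
Let `𝔤` be a finite-dimensional real stratified Lie algebra with strata
`g 0, …, g (r-1)`, let `B₁` be an inner product on `g 0` and let `B` be an adapted
inner product on `𝔤` (it restricts to `B₁` on `g 0`, the strata are pairwise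
`B`-orthogonal, and each bracket map `B_k : g 0 ⊗ g k → g (k+1)` restricted to the
orthogonal complement of its kernel is an isometric isomorphism onto `g (k+1)`).
If `f` is a Lie algebra automorphism of `𝔤` preserving each stratum whose
restriction to `g 0` preserves the inner product, then `f` preserves `B` on all
of `𝔤`. -/
theorem stmt1 (L : Type*) [LieRing L] [LieAlgebra ℝ L] [FiniteDimensional ℝ L]
    (r : ℕ) (hr : 0 < r) (g : Fin r → Submodule ℝ L)
    (hdirect : DirectSum.IsInternal g)
    (hstrat : ∀ j : ℕ, ∀ hj : j + 1 < r,
      Submodule.span ℝ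
          {z : L | ∃ x ∈ g ⟨0, hr⟩, ∃ y ∈ g ⟨j, Nat.lt_of_succ_lt hj⟩, z = ⁅x, y⁆}
        = g ⟨j + 1, hj⟩)
    (htop : ∀ j : Fin r, ∀ x ∈ g j, ∀ y ∈ g ⟨r - 1, Nat.sub_lt hr Nat.one_pos⟩,
      ⁅x, y⁆ = 0)
    (B₁ : LinearMap.BilinForm ℝ ↥(g ⟨0, hr⟩)) (hB₁ : IsInnerProduct B₁)
    (B : LinearMap.BilinForm ℝ L) (hB : IsInnerProduct B)
    -- `B` restricts to `B₁` on the first stratum: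
    (hBB₁ : ∀ x y : ↥(g ⟨0, hr⟩), B x y = B₁ x y)
    -- the strata are pairwise `B`-orthogonal:
    (horth : ∀ i j : Fin r, i ≠ j → ∀ x ∈ g i, ∀ y ∈ g j, B x y = 0)
    -- each bracket map restricted to the orthogonal complement of its kernel is an
    -- isometric linear isomorphism onto the next stratum:
    (hiso : ∀ k : ℕ, ∀ hk : k + 1 < r,
      let gk : Submodule ℝ L := g ⟨k, Nat.lt_of_succ_lt hk⟩
      let Bk : (↥(g ⟨0, hr⟩) ⊗[ℝ] ↥gk) →ₗ[ℝ] L := bracketTensorMap L (g ⟨0, hr⟩) gk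
      let T : LinearMap.BilinForm ℝ (↥(g ⟨0, hr⟩) ⊗[ℝ] ↥gk) :=
        LinearMap.BilinForm.tmul B₁ (LinearMap.BilinForm.restrict B gk)
      let K : Submodule ℝ (↥(g ⟨0, hr⟩) ⊗[ℝ] ↥gk) :=
        LinearMap.BilinForm.orthogonal T (LinearMap.ker Bk)
      Submodule.map Bk K = g ⟨k + 1, hk⟩ ∧
      (∀ z ∈ K, Bk z = 0 → z = 0) ∧
      (∀ z ∈ K, ∀ w ∈ K, B (Bk z) (Bk w) = T z w))
    (f : L →ₗ⁅ℝ⁆ L) (hf : Function.Bijective f)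
    (hgraded : ∀ j : Fin r, Submodule.map (f : L →ₗ[ℝ] L) (g j) = g j)
    (hf₁ : ∀ x ∈ g ⟨0, hr⟩, ∀ y ∈ g ⟨0, hr⟩, B (f x) (f y) = B x y) :
    ∀ X Y : L, B (f X) (f Y) = B X Y := by
  have hmem (j : Fin r) : ∀ x ∈ g j, (f : L →ₗ[ℝ] L) x ∈ g j := fun x hx ↦
    (hgraded j).le (Submodule.mem_map_of_mem hx)
  have hsurj (j : Fin r) : Function.Surjective ((f : L →ₗ[ℝ] L).restrict (hmem j)) := by
    rintro ⟨y, hy⟩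
    obtain ⟨x, hx, rfl⟩ := (hgraded j).ge hy
    exact ⟨⟨x, hx⟩, rfl⟩
  have hstratum : ∀ k (hk : k < r), ∀ x ∈ g ⟨k, hk⟩, ∀ y ∈ g ⟨k, hk⟩,
      B (f x) (f y) = B x y := by
    intro k
    induction k with
    | zero => exact fun _ ↦ hf₁
    | succ k ih =>
      intro hk x hx y hy
      have hk' : k < r := Nat.lt_of_succ_lt hk
      obtain ⟨hmap, -, hisom⟩ := hiso k hk
      rw [← hmap] at hx hy
      obtain ⟨z, hz, rfl⟩ := hx
      obtain ⟨w, hw, rfl⟩ := hy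
      have hT := tmul_map_map_of_isometry B₁ (LinearMap.BilinForm.restrict B (g ⟨k, hk'⟩))
        ((f : L →ₗ[ℝ] L).restrict (hmem ⟨0, hr⟩)) ((f : L →ₗ[ℝ] L).restrict (hmem ⟨k, hk'⟩))
        (fun x y ↦ by
          rw [← hBB₁, ← hBB₁]
          exact hf₁ x x.2 y y.2)
        (fun x y ↦ ih hk' x x.2 y y.2)
      have hφ := bracketTensorMap_map_restrict f (hmem ⟨0, hr⟩) (hmem ⟨k, hk'⟩)
      have hK {u} := map_mem_orthogonal_of_isometry _
        (LinearMap.ker (bracketTensorMap L (g ⟨0, hr⟩) (g ⟨k, hk'⟩))) _ hT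
        (TensorProduct.map_surjective (hsurj _) (hsurj _))
        (fun w hw ↦ by
          rw [LinearMap.mem_ker, hφ] at hw
          exact hf.1 (hw.trans (map_zero f).symm)) (z := u)
      rw [← hφ, ← hφ, hisom _ (hK hz) _ (hK hw), hT, hisom _ hz _ hw]
  have htop' (x : L) : x ∈ ⨆ j, g j := hdirect.submodule_iSup_eq_top ▸ Submodule.mem_top
  intro X Y
  induction htop' X using Submodule.iSup_induction' with
  | zero => simp
  | add a b _ _ ha hb => simp only [map_add, LinearMap.add_apply, ha, hb]
  | mem i x hx =>
    induction htop' Y using Submodule.iSup_induction' with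
    | zero => simp
    | add a b _ _ ha hb => simp only [map_add, ha, hb]
    | mem j y hy =>
      by_cases hij : i = j
      · subst hij
        exact hstratum i i.2 x hx y hy
      · rw [horth i j hij x hx y hy]
        exact horth i j hij _ (hmem i x hx) _ (hmem j y hy)
end

section
/- Let J and R be the linear maps of ℝ⁴ defined on the standard basis by Je₁ = e₃, Je₂ = e₄, Je₃ = −e₁, Je₄ = −e₂ and Re₁ = e₂, Re₂ = −e₁, Re₃ = −e₄, Re₄ = e₃, and let ω(x, y) = x₁y₃ − x₃y₁ + x₂y₄ − x₄y₂. If v₄ ∈ ℝ⁴ is a unit vector and v₃ = Rv₄, v₂ = −Jv₄, v₁ = −Rv₂, then v₁, v₂, v₃, v₄ is an orthonormal basis of ℝ⁴ and ω(v₁, v₃) = ω(v₂, v₄) = 1, while ω(v₁, v₂) = ω(v₁, v₄) = ω(v₂, v₃) = ω(v₃, v₄) = 0. -/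
open RealInnerProductSpace

/-- If `v₄ ∈ ℝ⁴` is a unit vector and `v₃ = Rv₄`, `v₂ = −Jv₄`, `v₁ = −Rv₂`, then
`v₁, v₂, v₃, v₄` is an orthonormal basis of `ℝ⁴` with `ω(v₁,v₃) = ω(v₂,v₄) = 1`
and all other `ω`-pairings zero; i.e. in the 5-dimensional Heisenberg algebra
`[v₁,v₃] = [v₂,v₄] = e₅` and all other brackets of the `vᵢ` vanish.
(`v 0 = v₁`, …, `v 3 = v₄`; coordinates are 0-indexed.) -/
theorem stmt9 (J R : EuclideanSpace ℝ (Fin 4) →ₗ[ℝ] EuclideanSpace ℝ (Fin 4))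
    (e : Fin 4 → EuclideanSpace ℝ (Fin 4))
    (he : ∀ i, e i = EuclideanSpace.single i 1)
    (hJ0 : J (e 0) = e 2) (hJ1 : J (e 1) = e 3)
    (hJ2 : J (e 2) = -e 0) (hJ3 : J (e 3) = -e 1)
    (hR0 : R (e 0) = e 1) (hR1 : R (e 1) = -e 0)
    (hR2 : R (e 2) = -e 3) (hR3 : R (e 3) = e 2)
    (ω : EuclideanSpace ℝ (Fin 4) → EuclideanSpace ℝ (Fin 4) → ℝ)
    (hω : ∀ x y, ω x y = x 0 * y 2 - x 2 * y 0 + x 1 * y 3 - x 3 * y 1)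
    (v₄ : EuclideanSpace ℝ (Fin 4)) (hv₄ : ‖v₄‖ = 1)
    (v : Fin 4 → EuclideanSpace ℝ (Fin 4))
    (hv3 : v 3 = v₄) (hv2 : v 2 = R v₄) (hv1 : v 1 = -J v₄) (hv0 : v 0 = -R (v 1)) :
    Orthonormal ℝ v ∧ Submodule.span ℝ (Set.range v) = ⊤ ∧
    ω (v 0) (v 2) = 1 ∧ ω (v 1) (v 3) = 1 ∧
    ω (v 0) (v 1) = 0 ∧ ω (v 0) (v 3) = 0 ∧
    ω (v 1) (v 2) = 0 ∧ ω (v 2) (v 3) = 0 := by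
  have map_eq (T : EuclideanSpace ℝ (Fin 4) →ₗ[ℝ] EuclideanSpace ℝ (Fin 4)) (x) :
      T x = x 0 • T (e 0) + x 1 • T (e 1) + x 2 • T (e 2) + x 3 • T (e 3) := by
    have hx : x = x 0 • e 0 + x 1 • e 1 + x 2 • e 2 + x 3 • e 3 := by
      ext i
      fin_cases i <;> simp [he]
    conv_lhs => rw [hx]
    simp only [map_add, map_smul]
  have R_apply (x) : R x = !₂[-x 1, x 0, x 3, -x 2] := by
    rw [map_eq R x, hR0, hR1, hR2, hR3]
    ext i
    fin_cases i <;> simp [he]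
  have J_apply (x) : J x = !₂[-x 2, -x 3, x 0, x 1] := by
    rw [map_eq J x, hJ0, hJ1, hJ2, hJ3]
    ext i
    fin_cases i <;> simp [he]
  have norm_sq : v₄ 0 ^ 2 + v₄ 1 ^ 2 + v₄ 2 ^ 2 + v₄ 3 ^ 2 = 1 := by
    simpa [hv₄, Fin.sum_univ_four] using (EuclideanSpace.real_norm_sq_eq v₄).symm
  have v_one : v 1 = !₂[v₄ 2, v₄ 3, -v₄ 0, -v₄ 1] := by
    rw [hv1, J_apply]
    ext i
    fin_cases i <;> simp
  have v_zero : v 0 = !₂[v₄ 3, -v₄ 2, v₄ 1, -v₄ 0] := by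
    rw [hv0, R_apply, v_one]
    ext i
    fin_cases i <;> simp
  rw [R_apply] at hv2
  have orthonormal : Orthonormal ℝ v := by
    rw [orthonormal_iff_ite]
    intro i j
    fin_cases i <;> fin_cases j <;>
      simp [PiLp.inner_apply, Fin.sum_univ_four, v_zero, v_one, hv2, hv3,
        -inner_self_eq_norm_sq_to_K] <;>
      linarith
  refine ⟨orthonormal,
    orthonormal.linearIndependent.span_eq_top_of_card_eq_finrank (by simp), ?_⟩
  simp only [hω, v_zero, v_one, hv2, hv3]
  refine ⟨?_, ?_, ?_, ?_, ?_, ?_⟩ <;> simp <;> linarith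
end

section
/- Let b₁, b₃ ∈ ℝ with b := sqrt(b₁² + b₃²) > 0, let a₀ = (a¹, a², a³, a⁴) ∈ ℝ⁴, (x₀, x⁵₀) = (x¹₀, x²₀, x³₀, x⁴₀, x⁵₀) ∈ ℝ⁵, and let a(s) = Φ(s)·a₀ where Φ(s) is the fundamental matrix [[cos(sb), −(b₃/b)sin(sb), 0, (b₁/b)sin(sb)], [(b₃/b)sin(sb), cos(sb), −(b₁/b)sin(sb), 0], [0, (b₁/b)sin(sb), cos(sb), (b₃/b)sin(sb)], [−(b₁/b)sin(sb), 0, −(b₃/b)sin(sb), cos(sb)]]. Define x¹(s) = x¹₀ + (sin(sb)/b)a¹ + b₃((cos(sb)−1)/b²)a² − b₁((cos(sb)−1)/b²)a⁴, x²(s) = x²₀ − b₃((cos(sb)−1)/b²)a¹ + (sin(sb)/b)a² + b₁((cos(sb)−1)/b²)a³, x³(s) = x³₀ − b₁((cos(sb)−1)/b²)a² + (sin(sb)/b)a³ − b₃((cos(sb)−1)/b²)a⁴, x⁴(s) = x⁴₀ + b₁((cos(sb)−1)/b²)a¹ + b₃((cos(sb)−1)/b²)a³ + (sin(sb)/b)a⁴,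 and x⁵(s) = x⁵₀ + ((cos(sb)−1)/(2b²))·( −(b₁a² + b₃a⁴)x¹₀ + (b₁a¹ + b₃a³)x²₀ − (b₃a² − b₁a⁴)x³₀ + (b₃a¹ − b₁a³)x⁴₀ ) + (sin(sb)/(2b))·( a³x¹₀ + a⁴x²₀ − a¹x³₀ − a²x⁴₀ ). Then x^i(0) = x^i₀ for i = 1,…,5, (x^i)'(s) = a^i(s) for i = 1,…,4 and all s, and (x⁵)'(s) = (1/2)·( a³(s)x¹(s) + a⁴(s)x²(s) − a¹(s)x³(s) − a²(s)x⁴(s) ) for all s. -/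
open Matrix

/-- A curve `s ↦ c + (cos (s b) - 1) / b² · u + sin (s b) / b · v` has velocity
`cos (s b) · v - sin (s b) / b · u`. -/
lemma hasDerivAt_add_cos_sub_one_add_sin {b : ℝ} (hb : b ≠ 0) (c u v s : ℝ) :
    HasDerivAt
      (fun t => c + (Real.cos (t * b) - 1) / b ^ 2 * u + Real.sin (t * b) / b * v)
      (Real.cos (s * b) * v - Real.sin (s * b) / b * u) s := by
  have hlin : HasDerivAt (fun t : ℝ => t * b) b s := by
    simpa using (hasDerivAt_id s).mul_const b
  refine (((((hlin.cos.sub_const 1).div_const (b ^ 2)).mul_const u).const_add c).add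
    ((hlin.sin.div_const b).mul_const v)).congr_deriv ?_
  field_simp
  ring

/-- The tangent horizontal curves of the tubular minimal non-horizontal surfaces of
the 5-dimensional Heisenberg group `ℍ²` with constant connection coefficients
`b₁, b₃`: the explicitly given curve `(x1, x2, x3, x4, x5)` starts at
`(x₀, x₅₀)`, has horizontal velocity `a(s) = Φ(s)·a₀` (with `Φ` the fundamental
matrix of the system) and is horizontal.
(`a₀ 0 = a¹`, …, `a₀ 3 = a⁴`, `x₀ 0 = x¹₀`, …, `x₀ 3 = x⁴₀`.) -/
theorem stmt12 (b₁ b₃ b : ℝ) (hb : b = Real.sqrt (b₁ ^ 2 + b₃ ^ 2)) (hbpos : 0 < b)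
    (a₀ x₀ : Fin 4 → ℝ) (x₅₀ : ℝ)
    (Φ : ℝ → Matrix (Fin 4) (Fin 4) ℝ)
    (hΦ : ∀ s, Φ s =
      !![Real.cos (s * b), -(b₃ / b) * Real.sin (s * b), 0, (b₁ / b) * Real.sin (s * b);
         (b₃ / b) * Real.sin (s * b), Real.cos (s * b), -(b₁ / b) * Real.sin (s * b), 0;
         0, (b₁ / b) * Real.sin (s * b), Real.cos (s * b), (b₃ / b) * Real.sin (s * b);
         -(b₁ / b) * Real.sin (s * b), 0, -(b₃ / b) * Real.sin (s * b), Real.cos (s * b)])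
    (a : ℝ → Fin 4 → ℝ) (ha : ∀ s, a s = (Φ s).mulVec a₀)
    (x1 x2 x3 x4 x5 : ℝ → ℝ)
    (hx1 : ∀ s, x1 s = x₀ 0 + (Real.sin (s * b) / b) * a₀ 0
        + b₃ * ((Real.cos (s * b) - 1) / b ^ 2) * a₀ 1
        - b₁ * ((Real.cos (s * b) - 1) / b ^ 2) * a₀ 3)
    (hx2 : ∀ s, x2 s = x₀ 1 - b₃ * ((Real.cos (s * b) - 1) / b ^ 2) * a₀ 0
        + (Real.sin (s * b) / b) * a₀ 1
        + b₁ * ((Real.cos (s * b) - 1) / b ^ 2) * a₀ 2)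
    (hx3 : ∀ s, x3 s = x₀ 2 - b₁ * ((Real.cos (s * b) - 1) / b ^ 2) * a₀ 1
        + (Real.sin (s * b) / b) * a₀ 2
        - b₃ * ((Real.cos (s * b) - 1) / b ^ 2) * a₀ 3)
    (hx4 : ∀ s, x4 s = x₀ 3 + b₁ * ((Real.cos (s * b) - 1) / b ^ 2) * a₀ 0
        + b₃ * ((Real.cos (s * b) - 1) / b ^ 2) * a₀ 2
        + (Real.sin (s * b) / b) * a₀ 3)
    (hx5 : ∀ s, x5 s = x₅₀
        + ((Real.cos (s * b) - 1) / (2 * b ^ 2)) *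
            (-(b₁ * a₀ 1 + b₃ * a₀ 3) * x₀ 0 + (b₁ * a₀ 0 + b₃ * a₀ 2) * x₀ 1
              - (b₃ * a₀ 1 - b₁ * a₀ 3) * x₀ 2 + (b₃ * a₀ 0 - b₁ * a₀ 2) * x₀ 3)
        + (Real.sin (s * b) / (2 * b)) *
            (a₀ 2 * x₀ 0 + a₀ 3 * x₀ 1 - a₀ 0 * x₀ 2 - a₀ 1 * x₀ 3)) :
    (x1 0 = x₀ 0 ∧ x2 0 = x₀ 1 ∧ x3 0 = x₀ 2 ∧ x4 0 = x₀ 3 ∧ x5 0 = x₅₀) ∧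
    (∀ s, HasDerivAt x1 (a s 0) s ∧ HasDerivAt x2 (a s 1) s ∧
      HasDerivAt x3 (a s 2) s ∧ HasDerivAt x4 (a s 3) s) ∧
    (∀ s, HasDerivAt x5
      ((1 / 2) * (a s 2 * x1 s + a s 3 * x2 s - a s 0 * x3 s - a s 1 * x4 s)) s) := by
  have hb0 : b ≠ 0 := hbpos.ne'
  have key := hasDerivAt_add_cos_sub_one_add_sin hb0
  refine ⟨by simp [hx1, hx2, hx3, hx4, hx5], fun s => ⟨?_, ?_, ?_, ?_⟩, fun s => ?_⟩
  · convert key (x₀ 0) (b₃ * a₀ 1 - b₁ * a₀ 3) (a₀ 0) s using 1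
    · funext t; rw [hx1]; ring
    · simp [ha, hΦ, mulVec, dotProduct, Fin.sum_univ_four]; ring
  · convert key (x₀ 1) (b₁ * a₀ 2 - b₃ * a₀ 0) (a₀ 1) s using 1
    · funext t; rw [hx2]; ring
    · simp [ha, hΦ, mulVec, dotProduct, Fin.sum_univ_four]; ring
  · convert key (x₀ 2) (-b₁ * a₀ 1 - b₃ * a₀ 3) (a₀ 2) s using 1
    · funext t; rw [hx3]; ring
    · simp [ha, hΦ, mulVec, dotProduct, Fin.sum_univ_four]; ring
  · convert key (x₀ 3) (b₁ * a₀ 0 + b₃ * a₀ 2) (a₀ 3) s using 1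
    · funext t; rw [hx4]; ring
    · simp [ha, hΦ, mulVec, dotProduct, Fin.sum_univ_four]; ring
  · convert key x₅₀
      ((-(b₁ * a₀ 1 + b₃ * a₀ 3) * x₀ 0 + (b₁ * a₀ 0 + b₃ * a₀ 2) * x₀ 1
        - (b₃ * a₀ 1 - b₁ * a₀ 3) * x₀ 2 + (b₃ * a₀ 0 - b₁ * a₀ 2) * x₀ 3) / 2)
      ((a₀ 2 * x₀ 0 + a₀ 3 * x₀ 1 - a₀ 0 * x₀ 2 - a₀ 1 * x₀ 3) / 2) s using 1
    · funext t; rw [hx5]; ring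
    · rw [hx1, hx2, hx3, hx4]
      simp [ha, hΦ, mulVec, dotProduct, Fin.sum_univ_four]
      ring
end

section
/- Let n ≥ 1 and let u : ℝ^{2n} → ℝ be defined by u(x₁,…,x_{2n}) = (1/4)·Σ_{j=1}^{n} (x_j² − x_{j+n}²). Define for j = 1,…,n the functions φ_j = ∂u/∂x_j − x_{j+n}/2 and φ_{j+n} = ∂u/∂x_{j+n} + x_j/2 on ℝ^{2n}, and set N² = Σ_{i=1}^{2n} φ_i². Then at every point of ℝ^{2n} where N² ≠ 0, Σ_{i=1}^{2n} ∂²u/∂x_i² − (1/N²)·Σ_{i,j=1}^{2n} φ_i·φ_j·∂²u/∂x_i∂x_j = 0; that is, the hyperbolic paraboloid graph {x_{2n+1} = u(x₁,…,x_{2n})} satisfies the minimal hypersurface equation of the Heisenberg group ℍⁿ. -/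
/-- The partial derivative `∂g/∂x_i` of a function `g : ℝᵐ → ℝ` (0-indexed). -/
noncomputable def pd {m : ℕ} (i : Fin m) (g : (Fin m → ℝ) → ℝ) (x : Fin m → ℝ) : ℝ :=
  fderiv ℝ g x (Pi.single i 1)

/-- Splitting a sum over `2n` coordinates into the pairs of coordinates `j` and `j + n`. -/
theorem sum_fin_two_mul {n : ℕ} {a b : Fin n → Fin (2 * n)} (ha : ∀ j, (a j : ℕ) = j)
    (hb : ∀ j, (b j : ℕ) = j + n) (f : Fin (2 * n) → ℝ) :
    ∑ i, f i = ∑ j, (f (a j) + f (b j)) := by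
  rw [← (finCongr (two_mul n).symm).sum_comp, Fin.sum_univ_add, ← Finset.sum_add_distrib]
  refine Finset.sum_congr rfl fun j _ => ?_
  congr 2 <;> exact Fin.ext (by simp [ha, hb, add_comm])

theorem pd_const_mul_apply {m : ℕ} (c : ℝ) (i j : Fin m) (x : Fin m → ℝ) :
    pd i (fun y => c * y j) x = if i = j then c else 0 := by
  have h := (hasFDerivAt_apply (𝕜 := ℝ) j x).const_mul c
  rw [pd, h.fderiv]
  simp [Pi.single_apply, eq_comm]

theorem pd_diagonal_quadratic {m : ℕ} (c : Fin m → ℝ) (i : Fin m) (x : Fin m → ℝ) :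
    pd i (fun y => ∑ k, c k * y k ^ 2) x = 2 * c i * x i := by
  have h := HasFDerivAt.fun_sum (u := Finset.univ) fun k _ =>
    ((hasFDerivAt_apply (𝕜 := ℝ) k x).pow 2).const_mul (c k)
  rw [pd, h.fderiv]
  simp [Pi.single_apply]
  ring

/-- The hyperbolic paraboloid graph `{x_{2n+1} = (1/4)·Σ_j (x_j² − x_{j+n}²)}`
satisfies the minimal hypersurface equation
`Σ u_{ii} − (1/N²)·Σ φ_i φ_j u_{ij} = 0` of the Heisenberg group `ℍⁿ` at every
non-characteristic point (where `N² = Σ φ_i² ≠ 0`),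
with `φ_j = ∂u/∂x_j − x_{j+n}/2` and `φ_{j+n} = ∂u/∂x_{j+n} + x_j/2`. -/
theorem stmt14 (n : ℕ) (hn : 1 ≤ n)
    (u : (Fin (2 * n) → ℝ) → ℝ)
    (hu : ∀ x, u x = (1 / 4) *
      ∑ j : Fin n, ((x ⟨(j : ℕ), by have := j.isLt; omega⟩) ^ 2
        - (x ⟨(j : ℕ) + n, by have := j.isLt; omega⟩) ^ 2))
    (φ : Fin (2 * n) → (Fin (2 * n) → ℝ) → ℝ)
    (hφ : ∀ (i : Fin (2 * n)) (x : Fin (2 * n) → ℝ), φ i x =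
      if h : (i : ℕ) < n then
        pd i u x - x ⟨(i : ℕ) + n, by omega⟩ / 2
      else
        pd i u x + x ⟨(i : ℕ) - n, by have := i.isLt; omega⟩ / 2)
    (Nsq : (Fin (2 * n) → ℝ) → ℝ)
    (hNsq : ∀ x, Nsq x = ∑ i, (φ i x) ^ 2)
    (x : Fin (2 * n) → ℝ) (hx : Nsq x ≠ 0) :
    (∑ i, pd i (fun y => pd i u y) x)
      - (1 / Nsq x) * ∑ i, ∑ j, φ i x * φ j x * pd i (fun y => pd j u y) x = 0 := by
  have hsplit (f : Fin (2 * n) → ℝ) := sum_fin_two_mul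
    (a := fun j : Fin n => ⟨j, by have := j.isLt; omega⟩)
    (b := fun j : Fin n => ⟨j + n, by have := j.isLt; omega⟩)
    (fun _ => rfl) (fun _ => rfl) f
  let ε : Fin (2 * n) → ℝ := fun i => if (i : ℕ) < n then 1 else -1
  have hu' : u = fun y => ∑ k, (ε k / 4) * y k ^ 2 := by
    funext y
    rw [hu, hsplit, Finset.mul_sum]
    refine Finset.sum_congr rfl fun j _ => ?_
    simp [ε]
    ring
  have hgrad (i) (y) : pd i u y = ε i / 2 * y i := by
    rw [hu', pd_diagonal_quadratic]
    ring
  have hhess (i j) : pd i (fun y => pd j u y) x = if i = j then ε j / 2 else 0 := by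
    simp only [hgrad, pd_const_mul_apply]
  have hlap : ∑ i, ε i / 2 = 0 := by
    rw [hsplit]
    exact Finset.sum_eq_zero fun j _ => by norm_num [ε]
  have hnormal : ∑ i, φ i x * φ i x * (ε i / 2) = 0 := by
    rw [hsplit]
    refine Finset.sum_eq_zero fun j _ => ?_
    simp [hφ, hgrad, ε]
    ring
  simp only [hhess, if_true, mul_ite, mul_zero, Finset.sum_ite_eq, Finset.mem_univ, hlap,
    hnormal, sub_zero]
end

section
/- Let r > 0 and define φ : ℝ² → ℝ⁵ by φ(t, s) = ( (r/2)·cos(t/r)·(1 + cos(2s/r)), (r/2)·sin(2s/r)·cos(t/r), (r/2)·sin(t/r)·(1 + cos(2s/r)), (r/2)·sin(2s/r)·sin(t/r), 0 ). Then for every fixed t, the curve s ↦ φ(t, s) is a horizontal curve of the 5-dimensional Heisenberg group ℍ² with unit-speed horizontal velocity: writing φ = (x¹, x², x³, x⁴, x⁵), one has ∂x⁵/∂s = (1/2)·( (∂x³/∂s)·x¹ + (∂x⁴/∂s)·x² − (∂x¹/∂s)·x³ − (∂x²/∂s)·x⁴ ) and (∂x¹/∂s)² + (∂x²/∂s)²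 + (∂x³/∂s)² + (∂x⁴/∂s)² = 1 at every (t, s). -/
/-- The parametrization `φ(t,s)` of the tubular minimal non-horizontal surface of
`ℍ²` generated by the transverse circle `γ(t) = (r·cos(t/r), 0, r·sin(t/r), 0, 0)`:
for every fixed `t`, the curve `s ↦ φ(t,s)` is horizontal with unit-speed
horizontal velocity. -/
theorem stmt18 (r : ℝ) (hr : 0 < r)
    (x1 x2 x3 x4 x5 : ℝ → ℝ → ℝ)
    (h1 : ∀ t s, x1 t s = (r / 2) * Real.cos (t / r) * (1 + Real.cos (2 * s / r)))
    (h2 : ∀ t s, x2 t s = (r / 2) * Real.sin (2 * s / r) * Real.cos (t / r))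
    (h3 : ∀ t s, x3 t s = (r / 2) * Real.sin (t / r) * (1 + Real.cos (2 * s / r)))
    (h4 : ∀ t s, x4 t s = (r / 2) * Real.sin (2 * s / r) * Real.sin (t / r))
    (h5 : ∀ t s, x5 t s = 0) :
    ∀ t s,
      (DifferentiableAt ℝ (x1 t) s ∧ DifferentiableAt ℝ (x2 t) s ∧
        DifferentiableAt ℝ (x3 t) s ∧ DifferentiableAt ℝ (x4 t) s ∧
        DifferentiableAt ℝ (x5 t) s) ∧
      deriv (x5 t) s = (1 / 2) * (deriv (x3 t) s * x1 t s + deriv (x4 t) s * x2 t s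
        - deriv (x1 t) s * x3 t s - deriv (x2 t) s * x4 t s) ∧
      (deriv (x1 t) s) ^ 2 + (deriv (x2 t) s) ^ 2
        + (deriv (x3 t) s) ^ 2 + (deriv (x4 t) s) ^ 2 = 1 := by
  intro t s
  have hr0 : r ≠ 0 := hr.ne'
  have hl : HasDerivAt (fun s : ℝ => 2 * s / r) (2 / r) s := by
    simpa using ((hasDerivAt_id s).const_mul 2).div_const r
  have d1 : HasDerivAt (x1 t) (-(Real.cos (t / r) * Real.sin (2 * s / r))) s := by
    rw [funext (h1 t)]
    refine ((hl.cos.const_add 1).const_mul _).congr_deriv ?_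
    field_simp
  have d2 : HasDerivAt (x2 t) (Real.cos (2 * s / r) * Real.cos (t / r)) s := by
    rw [funext (h2 t)]
    refine ((hl.sin.const_mul _).mul_const _).congr_deriv ?_
    field_simp
  have d3 : HasDerivAt (x3 t) (-(Real.sin (t / r) * Real.sin (2 * s / r))) s := by
    rw [funext (h3 t)]
    refine ((hl.cos.const_add 1).const_mul _).congr_deriv ?_
    field_simp
  have d4 : HasDerivAt (x4 t) (Real.cos (2 * s / r) * Real.sin (t / r)) s := by
    rw [funext (h4 t)]
    refine ((hl.sin.const_mul _).mul_const _).congr_deriv ?_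
    field_simp
  have d5 : HasDerivAt (x5 t) 0 s := by
    rw [funext (h5 t)]
    exact hasDerivAt_const s 0
  refine ⟨⟨d1.differentiableAt, d2.differentiableAt, d3.differentiableAt,
    d4.differentiableAt, d5.differentiableAt⟩, ?_, ?_⟩
  · rw [d1.deriv, d2.deriv, d3.deriv, d4.deriv, d5.deriv, h1, h2, h3, h4]
    ring
  · rw [d1.deriv, d2.deriv, d3.deriv, d4.deriv]
    linear_combination
      (Real.sin (2 * s / r) ^ 2 + Real.cos (2 * s / r) ^ 2) * Real.sin_sq_add_cos_sq (t / r)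
        + Real.sin_sq_add_cos_sq (2 * s / r)
end
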